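/- arXiv:1201.0181 — 5 statements merged into one kernel-verified Lean document; each statement's English description precedes it below -/
import Mathlib

section
/- Let A be a 2×2-matrix-valued function holomorphic on a punctured neighborhood of 0 ∈ ℂ such that the function ξ ↦ A(ξ) + K/ξ − A₀ − A₁ξ extends holomorphically to ξ = 0 and vanishes there to order at least 2, where K = diag(−1,1) and A₀, A₁ are constant 2×2 complex matrices with (A₀)₁₂ = 0. Let D(ξ) = diag(ξ⁻¹, ξ). Then the gauge-transformed coefficient matrix Ã(ξ) := D′(ξ)·D(ξ)⁻¹ + D(ξ)·A(ξ)·D(ξ)⁻¹ satisfies: the function ξ ↦ Ã(ξ) − (A₁)₁₂·E₁₂/ξ extends holomorphically to ξ = 0, where E₁₂ is the 2×2 matrix whose only nonzero entry is a 1 in position (1,2). In particular, Ã has a pole of order at most one at ξ = 0 with nilpotent residue (A₁)₁₂·E₁₂. -/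
/-- `M2` is the space of 2×2 complex matrices. -/
abbrev M2 : Type := Matrix (Fin 2) (Fin 2) ℂ

attribute [local instance] Matrix.linftyOpNormedAddCommGroup Matrix.linftyOpNormedRing
  Matrix.linftyOpNormedAlgebra

open scoped Topology

/-- Each entry of an analytic matrix-valued function is analytic. -/
lemma AnalyticAt.matrix_entry {h : ℂ → M2} {x : ℂ} (hh : AnalyticAt ℂ h x) (i j : Fin 2) :
    AnalyticAt ℂ (fun ξ => h ξ i j) x :=
  ((Matrix.entryLinearMap ℂ ℂ i j : M2 →ₗ[ℂ] ℂ).toContinuousLinearMap.analyticAt (h x)).comp hh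

lemma matrix_two_eq_sum_smul (a b c d : ℂ) :
    (!![a, b; c, d] : M2) = a • !![1, 0; 0, 0] + b • !![0, 1; 0, 0] + c • !![0, 0; 1, 0]
      + d • !![0, 0; 0, 1] := by
  ext i j
  fin_cases i <;> fin_cases j <;> simp

/-- A 2×2-matrix-valued function with analytic entries is analytic. -/
lemma analyticAt_matrix_two {a b c d : ℂ → ℂ} {x : ℂ} (ha : AnalyticAt ℂ a x)
    (hb : AnalyticAt ℂ b x) (hc : AnalyticAt ℂ c x) (hd : AnalyticAt ℂ d x) :
    AnalyticAt ℂ (fun ξ => (!![a ξ, b ξ; c ξ, d ξ] : M2)) x := by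
  simp only [matrix_two_eq_sum_smul (a _)]
  exact (((ha.smul analyticAt_const).add (hb.smul analyticAt_const)).add
    (hc.smul analyticAt_const)).add (hd.smul analyticAt_const)

lemma deriv_diag_inv_id {ξ : ℂ} (hξ : ξ ≠ 0) :
    deriv (fun z : ℂ => (!![z⁻¹, 0; 0, z] : M2)) ξ = !![-(ξ ^ 2)⁻¹, 0; 0, 1] := by
  have h1 := (hasDerivAt_inv hξ).smul_const (!![1, 0; 0, 0] : M2)
  have h2 := (hasDerivAt_id ξ).smul_const (!![0, 0; 0, 1] : M2)
  have hf : (fun z : ℂ => (!![z⁻¹, 0; 0, z] : M2)) =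
      (fun z => z⁻¹ • !![1, 0; 0, 0]) + fun z => id z • !![0, 0; 0, 1] := by
    ext z i j
    fin_cases i <;> fin_cases j <;> simp
  rw [hf]
  refine (h1.add h2).deriv.trans ?_
  ext i j
  fin_cases i <;> fin_cases j <;> simp

/-- Gauge computation at the apparent singularity ξ = 0: if
A(ξ) = −K/ξ + A₀ + A₁ξ + O(ξ²) with K = diag(−1,1) and (A₀)₁₂ = 0, then for
D(ξ) = diag(ξ⁻¹, ξ) the gauge-transformed matrix Ã = D′D⁻¹ + DAD⁻¹ has at most a simple
pole at ξ = 0 with nilpotent residue (A₁)₁₂·E₁₂. -/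
theorem stmt_1 (A : ℂ → M2) (K A0 A1 : M2)
    (hK : K = !![(-1 : ℂ), 0; 0, 1])
    (hA0 : A0 0 1 = 0)
    (hAhol : ∀ᶠ ξ in 𝓝[≠] (0 : ℂ), AnalyticAt ℂ A ξ)
    -- `A(ξ) + K/ξ − A₀ − A₁ξ` extends holomorphically to `ξ = 0` and vanishes there to
    -- order at least `2`:
    (hexp : ∃ h : ℂ → M2, AnalyticAt ℂ h 0 ∧
      ∀ᶠ ξ in 𝓝[≠] (0 : ℂ), A ξ + ξ⁻¹ • K - A0 - ξ • A1 = ξ ^ 2 • h ξ)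
    (D : ℂ → M2) (hD : ∀ ξ : ℂ, D ξ = !![ξ⁻¹, 0; 0, ξ])
    (Atilde : ℂ → M2)
    (hAtilde : ∀ ξ : ℂ, ξ ≠ 0 → Atilde ξ = deriv D ξ * (D ξ)⁻¹ + D ξ * A ξ * (D ξ)⁻¹) :
    ∃ g : ℂ → M2, AnalyticAt ℂ g 0 ∧
      ∀ᶠ ξ in 𝓝[≠] (0 : ℂ), g ξ = Atilde ξ - ξ⁻¹ • (A1 0 1 • !![(0 : ℂ), 1; 0, 0]) := by
  obtain ⟨h, hh, he⟩ := hexp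
  have hid : AnalyticAt ℂ (fun ξ : ℂ => ξ) 0 := analyticAt_id
  have entry (i j : Fin 2) :
      AnalyticAt ℂ (fun ξ => A0 i j + ξ * A1 i j + ξ ^ 2 * h ξ i j) 0 :=
    (analyticAt_const.add (hid.mul analyticAt_const)).add ((hid.pow 2).mul (hh.matrix_entry i j))
  refine ⟨_, analyticAt_matrix_two (entry 0 0) (hh.matrix_entry 0 1)
    ((hid.pow 2).mul (entry 1 0)) (entry 1 1), ?_⟩
  filter_upwards [he, self_mem_nhdsWithin] with ξ hξ hne
  have hne : ξ ≠ 0 := hne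
  have hinv : (!![ξ⁻¹, 0; 0, ξ] : M2)⁻¹ = !![ξ, 0; 0, ξ⁻¹] := by
    apply Matrix.inv_eq_right_inv
    ext i j
    fin_cases i <;> fin_cases j <;> simp [Matrix.mul_apply, hne]
  have hA : A ξ = A0 + ξ • A1 + ξ ^ 2 • h ξ - ξ⁻¹ • K := by
    rw [← hξ]
    abel
  have hderiv : deriv D ξ = !![-(ξ ^ 2)⁻¹, 0; 0, 1] := by
    rw [show D = _ from funext hD]
    exact deriv_diag_inv_id hne
  rw [hAtilde ξ hne, hderiv, hD, hinv, hA, hK]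
  ext i j
  simp only [Matrix.sub_apply, Matrix.add_apply, Matrix.mul_apply, Matrix.smul_apply,
    Fin.sum_univ_two]
  fin_cases i <;> fin_cases j <;> simp [hA0] <;> field_simp <;> ring
end

section
/- Let a₁,…,aₙ, B₁₂, B₂₂, B₁₁,…,Bₙ₁ and B(z) = B₁₂/(z−a₁)² + B₂₂/(z−a₂)² + Σᵢ₌₁ⁿ Bᵢ₁/(z−aᵢ) be as follows: the aᵢ are complex numbers and the coefficients are 2×2 complex matrices. Suppose Y(z) = U(z)·diag(z⁻¹, z) satisfies Y′(z) = B(z)·Y(z) for |z| > R (R > maxᵢ |aᵢ|), where U is holomorphic at ∞ with U(∞) = I and first Laurent coefficient U₁ (i.e. U(z) = I + U₁/z + O(1/z²)). Then, with K = diag(−1,1), one has −U₁ + U₁K − KU₁ = Σᵢ₌₁ⁿ Bᵢ₁aᵢ + B₁₂ + B₂₂; in particular, the (1,2)-entry of U₁ equals the (1,2)-entry of Σᵢ₌₁ⁿ Bᵢ₁aᵢ + B₁₂ + B₂₂. -/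
attribute [local instance] Matrix.linftyOpNormedAddCommGroup Matrix.linftyOpNormedRing
  Matrix.linftyOpNormedAlgebra

open scoped Topology

/-- The matrix `diag(z⁻¹, z)` has derivative `z⁻¹ • K * diag(z⁻¹, z)` with `K = diag(-1, 1)`. -/
theorem hasDerivAt_diag_inv_self {z : ℂ} (hz : z ≠ 0) :
    HasDerivAt (fun z : ℂ => (!![z⁻¹, 0; 0, z] : M2))
      ((z⁻¹ • !![(-1 : ℂ), 0; 0, 1]) * !![z⁻¹, 0; 0, z]) z := by
  have h := ((hasDerivAt_inv hz).smul_const (!![1, 0; 0, 0] : M2)).add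
    ((hasDerivAt_id z).smul_const (!![0, 0; 0, 1] : M2))
  have hfun : (fun x : ℂ => (!![x⁻¹, 0; 0, x] : M2)) =
      (fun x : ℂ => x⁻¹ • (!![1, 0; 0, 0] : M2)) + fun x => id x • (!![0, 0; 0, 1] : M2) := by
    funext x
    ext i j
    fin_cases i <;> fin_cases j <;> simp
  rw [hfun]
  refine h.congr_deriv ?_
  ext i j
  fin_cases i <;> fin_cases j <;> simp [hz, pow_two]

theorem isUnit_diag_inv_self {z : ℂ} (hz : z ≠ 0) : IsUnit (!![z⁻¹, 0; 0, z] : M2) := by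
  rw [Matrix.isUnit_iff_isUnit_det]
  simp [Matrix.det_fin_two, hz]

/-- The gauge-transformed equation: if `Y = V(z⁻¹) diag(z⁻¹, z)` near `z` solves `Y' = B Y`
at `z = w⁻¹`, then `V` satisfies a linear equation at `w`. -/
theorem neg_sq_smul_add_smul_mul_eq {V Y : ℂ → M2} {b : M2} {w : ℂ} (hw : w ≠ 0)
    (hV : DifferentiableAt ℂ V w)
    (hY : ∀ᶠ z in 𝓝 w⁻¹, Y z = V z⁻¹ * !![z⁻¹, 0; 0, z])
    (hode : HasDerivAt Y (b * Y w⁻¹) w⁻¹) :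
    -(w ^ 2) • deriv V w + w • (V w * !![(-1 : ℂ), 0; 0, 1]) = b * V w := by
  have hz : w⁻¹ ≠ 0 := inv_ne_zero hw
  have hV' : HasDerivAt V (deriv V w) (w⁻¹)⁻¹ := by
    rw [inv_inv]
    exact hV.hasDerivAt
  have hprod := (hV'.scomp w⁻¹ (hasDerivAt_inv hz)).mul (hasDerivAt_diag_inv_self hz)
  have heq := hode.unique (hprod.congr_of_eventuallyEq hY)
  rw [hY.self_of_nhds, ← mul_assoc] at heq
  simp only [Function.comp_apply, inv_inv, inv_pow] at heq
  rw [← mul_assoc, ← add_mul] at heq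
  have hu := isUnit_diag_inv_self hz
  rw [inv_inv] at hu
  rw [hu.mul_left_injective heq, Matrix.mul_smul]

/-- For a linear system with coefficient matrix B(z) = B₁₂/(z−a₁)² + B₂₂/(z−a₂)²
+ Σᵢ Bᵢ₁/(z−aᵢ) admitting near ∞ a fundamental matrix Y(z) = U(z)·diag(z⁻¹,z), where
U(z) = I + U₁/z + O(1/z²), one has, with K = diag(−1,1),
−U₁ + U₁K − KU₁ = Σᵢ Bᵢ₁aᵢ + B₁₂ + B₂₂; in particular the (1,2)-entries coincide. -/
theorem stmt_3 (n : ℕ) (hn : 2 ≤ n) (a : Fin n → ℂ)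
    (B12 B22 : M2) (B1 : Fin n → M2)
    (B : ℂ → M2)
    (hB : ∀ z : ℂ, B z = ((z - a ⟨0, by omega⟩) ^ 2)⁻¹ • B12
        + ((z - a ⟨1, by omega⟩) ^ 2)⁻¹ • B22
        + ∑ i, (z - a i)⁻¹ • B1 i)
    (R : ℝ) (hR : ∀ i, ‖a i‖ < R)
    (U Y : ℂ → M2)
    -- `U` is holomorphic at `∞` with `U(∞) = I`, and `U₁` is its first Laurent
    -- coefficient at `∞`, i.e. `U(z) = I + U₁/z + O(1/z²)`:
    (V : ℂ → M2) (hV : AnalyticAt ℂ V 0) (hV0 : V 0 = 1)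
    (hUV : ∀ z : ℂ, R < ‖z‖ → U z = V z⁻¹)
    (U1 : M2) (hU1 : U1 = deriv V 0)
    (hY : ∀ z : ℂ, R < ‖z‖ → Y z = U z * !![z⁻¹, 0; 0, z])
    (hode : ∀ z : ℂ, R < ‖z‖ → HasDerivAt Y (B z * Y z) z)
    (K : M2) (hK : K = !![(-1 : ℂ), 0; 0, 1]) :
    -U1 + U1 * K - K * U1 = (∑ i, a i • B1 i) + B12 + B22 ∧
      U1 0 1 = ((∑ i, a i • B1 i) + B12 + B22) 0 1 := by
  subst hU1 hK
  set a0 := a ⟨0, by omega⟩ with ha0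
  set a1 := a ⟨1, by omega⟩ with ha1
  have hR0 : 0 < R := (norm_nonneg _).trans_lt (hR ⟨0, by omega⟩)
  set L : M2 := !![(-1 : ℂ), 0; 0, 1] with hL
  set C : ℂ → M2 := fun w => (w * ((1 - a0 * w) ^ 2)⁻¹) • B12
    + (w * ((1 - a1 * w) ^ 2)⁻¹) • B22 + ∑ i, (1 - a i * w)⁻¹ • B1 i with hC
  have hBC : ∀ w : ℂ, w ≠ 0 → B w⁻¹ = w • C w := by
    intro w hw
    have hsub : ∀ c : ℂ, (w⁻¹ - c)⁻¹ = w * (1 - c * w)⁻¹ := by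
      intro c
      rw [show w⁻¹ - c = w⁻¹ * (1 - c * w) by field_simp, mul_inv, inv_inv]
    simp only [hB, hC, ← inv_pow, hsub, smul_add, Finset.smul_sum, smul_smul]
    congr 3 <;> ring
  have hinv : ∀ c : ℂ, HasDerivAt (fun w : ℂ => (1 - c * w)⁻¹) c 0 := by
    intro c
    have h := ((hasDerivAt_id (0 : ℂ)).const_mul c).const_sub 1
    have h2 := h.fun_inv (by simp)
    simpa using h2
  have hpole : ∀ c : ℂ, HasDerivAt (fun w : ℂ => w * ((1 - c * w) ^ 2)⁻¹) 1 0 := by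
    intro c
    have h := (hasDerivAt_id (0 : ℂ)).mul ((hinv c).pow 2)
    simp only [← inv_pow]
    exact h.congr_deriv (by simp)
  have hCd : HasDerivAt C ((∑ i, a i • B1 i) + B12 + B22) 0 := by
    have h := (((hpole a0).smul_const B12).add ((hpole a1).smul_const B22)).add
      (HasDerivAt.fun_sum (u := Finset.univ) fun i _ => (hinv (a i)).smul_const (B1 i))
    refine h.congr_deriv ?_
    rw [one_smul, one_smul]
    abel
  have hV1 : HasDerivAt V (deriv V 0) 0 := hV.differentiableAt.hasDerivAt
  have hVd : HasDerivAt (deriv V) (deriv (deriv V) 0) 0 :=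
    hV.deriv.differentiableAt.hasDerivAt
  have hF : HasDerivAt (fun w => -(w • deriv V w) + V w * L) (-deriv V 0 + deriv V 0 * L) 0 := by
    have h := ((hasDerivAt_id (0 : ℂ)).smul hVd).neg.add (hV1.mul_const L)
    exact h.congr_deriv (by simp)
  have hG : HasDerivAt (fun w => C w * V w)
      (((∑ i, a i • B1 i) + B12 + B22) * V 0 + C 0 * deriv V 0) 0 := hCd.mul hV1
  have hpunct : ∀ᶠ w in 𝓝[≠] (0 : ℂ), -(w • deriv V w) + V w * L = C w * V w := by
    have hsmall : ∀ᶠ w in 𝓝[≠] (0 : ℂ), ‖w‖ < R⁻¹ :=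
      nhdsWithin_le_nhds ((continuous_norm.tendsto' (0 : ℂ) 0 norm_zero).eventually_lt_const
        (inv_pos.mpr hR0))
    filter_upwards [hsmall, self_mem_nhdsWithin,
      nhdsWithin_le_nhds hV.eventually_analyticAt] with w hwR hw hVw
    have hw : w ≠ 0 := hw
    have hz : R < ‖w⁻¹‖ := by
      rw [norm_inv]
      exact (lt_inv_comm₀ hR0 (norm_pos_iff.mpr hw)).mpr hwR
    have h := neg_sq_smul_add_smul_mul_eq hw hVw.differentiableAt
      (Y := Y) (b := B w⁻¹) (by
        filter_upwards [continuous_norm.continuousAt.eventually_const_lt hz] with z hz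
        rw [hY z hz, hUV z hz]) (hode _ hz)
    rw [hBC w hw, smul_mul_assoc] at h
    refine smul_right_injective M2 hw ?_
    simp only [← h, smul_add, smul_neg, smul_smul, pow_two, neg_smul, hL]
  have hev : (fun w => -(w • deriv V w) + V w * L) =ᶠ[𝓝 0] fun w => C w * V w :=
    (hF.continuousAt.eventuallyEq_nhds_iff_eventuallyEq_nhdsNE hG.continuousAt).mp hpunct
  have hC0 : L = C 0 := by simpa [hV0] using hev.self_of_nhds
  have hd := hF.unique (hG.congr_of_eventuallyEq hev)
  rw [hV0, mul_one, ← hC0] at hd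
  have hmain : -deriv V 0 + deriv V 0 * L - L * deriv V 0 = (∑ i, a i • B1 i) + B12 + B22 := by
    rw [hd, add_sub_cancel_right]
  refine ⟨hmain, ?_⟩
  rw [← hmain]
  simp only [Matrix.add_apply, Matrix.sub_apply, Matrix.neg_apply, Matrix.mul_apply,
    Fin.sum_univ_two, hL]
  simp
end

section
/- Let U be a 2×2-matrix-valued function holomorphic at ∞ with U(∞) = I and Laurent expansion U(z) = I + U₁/z + U₂/z² + O(1/z³), and suppose u₁ := (U₁)₁₂ ≠ 0. Fix c ∈ ℂ and define Γ(z) = [[z + c, −u₁],[1/u₁, 0]]. Then det Γ(z) = 1 for every z ∈ ℂ (so Γ is holomorphically invertible on all of ℂ), and the function W(z) := Γ(z)·U(z)·diag(z⁻¹, z) extends holomorphically to ∞ with W(∞) = [[1, c·u₁ + (U₂)₁₂ − u₁·(U₁)₂₂],[0, 1]], which is an invertible matrix. -/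
attribute [local instance] Matrix.linftyOpNormedAddCommGroup Matrix.linftyOpNormedRing
  Matrix.linftyOpNormedAlgebra

open scoped Topology

/-- The slope of an analytic function, extended by the derivative, is analytic at the base point. -/
theorem AnalyticAt.dslope_self {E : Type*} [NormedAddCommGroup E] [NormedSpace ℂ E] {f : ℂ → E}
    {a : ℂ} (hf : AnalyticAt ℂ f a) : AnalyticAt ℂ (dslope f a) a := by
  obtain ⟨p, hp⟩ := hf
  exact hp.has_fpower_series_dslope_fslope.analyticAt

/-- The value of the second divided difference at the base point is half the second derivative. -/
theorem AnalyticAt.dslope_dslope_same {E : Type*} [NormedAddCommGroup E] [NormedSpace ℂ E]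
    [CompleteSpace E] {f : ℂ → E} {a : ℂ} (hf : AnalyticAt ℂ f a) :
    dslope (dslope f a) a a = (2 : ℂ)⁻¹ • iteratedDeriv 2 f a := by
  obtain ⟨p, hp⟩ := hf
  have h1 := hp.has_fpower_series_dslope_fslope.has_fpower_series_dslope_fslope.coeff_zero
    (fun _ => 1)
  obtain ⟨r, hr⟩ := hp
  have h2 := hr.factorial_smul 1 2
  rw [iteratedDeriv_eq_iteratedFDeriv, ← h2, ← h1]
  change p.fslope.fslope.coeff 0 = (2 : ℂ)⁻¹ • Nat.factorial 2 • p.coeff 2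
  rw [FormalMultilinearSeries.coeff_fslope, FormalMultilinearSeries.coeff_fslope,
    ← Nat.cast_smul_eq_nsmul ℂ, smul_smul]
  norm_num [Nat.factorial]

/-- For U holomorphic at ∞ with U(z) = I + U₁/z + U₂/z² + O(1/z³) and u₁ = (U₁)₁₂ ≠ 0,
the gauge Γ(z) = [[z+c, −u₁],[1/u₁, 0]] has det Γ ≡ 1 and
W(z) = Γ(z)·U(z)·diag(z⁻¹,z) extends holomorphically to ∞ with invertible value
W(∞) = [[1, c·u₁ + (U₂)₁₂ − u₁·(U₁)₂₂],[0,1]]. -/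
theorem stmt_6 (R : ℝ) (U : ℂ → M2)
    -- `U` is holomorphic at `∞` with `U(∞) = I`, with Laurent coefficients `U₁`, `U₂`:
    (V : ℂ → M2) (hV : AnalyticAt ℂ V 0) (hV0 : V 0 = 1)
    (hUV : ∀ z : ℂ, R < ‖z‖ → U z = V z⁻¹)
    (U1 U2 : M2) (hU1 : U1 = deriv V 0) (hU2 : U2 = (2 : ℂ)⁻¹ • iteratedDeriv 2 V 0)
    (u1 : ℂ) (hu1 : u1 = U1 0 1) (hu1ne : u1 ≠ 0)
    (c : ℂ)
    (Γ : ℂ → M2) (hΓ : ∀ z : ℂ, Γ z = !![z + c, -u1; u1⁻¹, 0])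
    (W : ℂ → M2)
    (hW : ∀ z : ℂ, R < ‖z‖ → W z = Γ z * U z * !![z⁻¹, 0; 0, z]) :
    (∀ z : ℂ, (Γ z).det = 1) ∧
      ∃ g : ℂ → M2, AnalyticAt ℂ g 0 ∧
        (∀ᶠ w in 𝓝[≠] (0 : ℂ), g w = W w⁻¹) ∧
        g 0 = !![1, c * u1 + U2 0 1 - u1 * U1 1 1; 0, 1] ∧ IsUnit (g 0) := by
  have hdet : ∀ z : ℂ, (Γ z).det = 1 := fun z => by
    simp [hΓ, Matrix.det_fin_two, hu1ne]
  refine ⟨hdet, ?_⟩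
  set V' := dslope V 0 with hV'
  set V'' := dslope V' 0 with hV''
  have hV'an : AnalyticAt ℂ V' 0 := hV.dslope_self
  have hV''an : AnalyticAt ℂ V'' 0 := hV'an.dslope_self
  have hV'0 : V' 0 = U1 := (dslope_same V 0).trans hU1.symm
  have hV''0 : V'' 0 = U2 := by rw [hV'', hV', hV.dslope_dslope_same, hU2]
  have hVexp : ∀ w, V w = 1 + w • V' w := fun w => by
    have := sub_smul_dslope V 0 w
    rw [sub_zero, hV0] at this
    rw [hV', this, add_sub_cancel]
  have hV'exp : ∀ w, V' w = U1 + w • V'' w := fun w => by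
    have := sub_smul_dslope V' 0 w
    rw [sub_zero, hV'0] at this
    rw [hV'', this, add_sub_cancel]
  let A : M2 := !![1, 0; 0, 0]
  let B : M2 := !![c, -u1; u1⁻¹, 0]
  let Q : M2 := !![0, 0; 0, 1]
  let g : ℂ → M2 := fun w => A * V w * A + w • (B * V w * A) + A * V'' w * Q + B * V' w * Q
  have hg0 : g 0 = !![1, c * u1 + U2 0 1 - u1 * U1 1 1; 0, 1] := by
    simp only [g, hV0, hV'0, hV''0]
    ext i j
    fin_cases i <;> fin_cases j <;>
      simp only [Matrix.add_apply, Matrix.smul_apply, Matrix.mul_apply, Fin.sum_univ_two] <;>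
      simp [A, B, Q, ← hu1, hu1ne]
    ring
  refine ⟨g, by fun_prop, ?_, hg0, ?_⟩
  · have hlarge : ∀ᶠ w in 𝓝[≠] (0 : ℂ), R < ‖w⁻¹‖ :=
      (tendsto_norm_cobounded_atTop.comp Filter.tendsto_inv₀_nhdsNE_zero).eventually_gt_atTop R
    filter_upwards [hlarge, self_mem_nhdsWithin] with w hw hw0
    replace hw0 : w ≠ 0 := hw0
    rw [hW _ hw, hUV _ hw, hΓ, inv_inv]
    simp only [g]
    rw [hVexp w, hV'exp w]
    ext i j
    fin_cases i <;> fin_cases j <;>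
      simp only [Matrix.add_apply, Matrix.smul_apply, Matrix.mul_apply, Fin.sum_univ_two] <;>
      simp [A, B, Q, ← hu1] <;> field_simp <;> ring
  · rw [Matrix.isUnit_iff_isUnit_det, hg0]
    simp [Matrix.det_fin_two]
end

section
/- Let m ≥ 1, let D ⊆ ℂᵐ be open, and let u, f, g: D → ℂ and M, N: D → M₂(ℂ) be holomorphic. For t ∈ D with u(t) ≠ 0, define Γ(t) = [[g(t) + f(t)/u(t), −u(t)],[1/u(t), 0]], and let E₁₁ = [[1,0],[0,0]] and E₂₂ = [[0,0],[0,1]]. Then the function t ↦ u(t)²·(E₁₁·M(t)·Γ(t)⁻¹ + Γ(t)·N(t)·Γ(t)⁻¹ + Γ(t)·M(t)·E₂₂), defined on {t ∈ D : u(t) ≠ 0}, extends to a holomorphic function on all of D. -/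
attribute [local instance] Matrix.linftyOpNormedAddCommGroup Matrix.linftyOpNormedRing
  Matrix.linftyOpNormedAlgebra

/-- For holomorphic u, f, g : D → ℂ and M, N : D → M₂(ℂ) on an open D ⊆ ℂᵐ, with
Γ(t) = [[g(t)+f(t)/u(t), −u(t)],[1/u(t), 0]], E₁₁ = [[1,0],[0,0]], E₂₂ = [[0,0],[0,1]],
the function u²·(E₁₁·M·Γ⁻¹ + Γ·N·Γ⁻¹ + Γ·M·E₂₂) extends holomorphically to all of D. -/
theorem stmt_10 (m : ℕ) (hm : 1 ≤ m) (D : Set (Fin m → ℂ)) (hD : IsOpen D)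
    (u f g : (Fin m → ℂ) → ℂ) (M N : (Fin m → ℂ) → M2)
    (hu : ∀ t ∈ D, AnalyticAt ℂ u t) (hf : ∀ t ∈ D, AnalyticAt ℂ f t)
    (hg : ∀ t ∈ D, AnalyticAt ℂ g t) (hM : ∀ t ∈ D, AnalyticAt ℂ M t)
    (hN : ∀ t ∈ D, AnalyticAt ℂ N t)
    (Γ : (Fin m → ℂ) → M2)
    (hΓ : ∀ t ∈ D, u t ≠ 0 → Γ t = !![g t + f t / u t, -u t; (u t)⁻¹, 0])
    (E11 E22 : M2) (hE11 : E11 = !![(1 : ℂ), 0; 0, 0]) (hE22 : E22 = !![(0 : ℂ), 0; 0, 1]) :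
    ∃ Φ : (Fin m → ℂ) → M2, (∀ t ∈ D, AnalyticAt ℂ Φ t) ∧
      ∀ t ∈ D, u t ≠ 0 →
        Φ t = (u t) ^ 2 • (E11 * M t * (Γ t)⁻¹ + Γ t * N t * (Γ t)⁻¹ + Γ t * M t * E22) := by
  let A : (Fin m → ℂ) → M2 := fun t =>
    (u t * g t + f t) • !![(1 : ℂ), 0; 0, 0] + u t ^ 2 • !![(0 : ℂ), -1; 0, 0] +
      !![(0 : ℂ), 0; 1, 0]
  let B : (Fin m → ℂ) → M2 := fun t =>
    (u t * g t + f t) • !![(0 : ℂ), 0; 0, 1] + u t ^ 2 • !![(0 : ℂ), 1; 0, 0] +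
      !![(0 : ℂ), 0; -1, 0]
  refine ⟨fun t => u t • (E11 * M t * B t) + A t * N t * B t + u t • (A t * M t * E22), ?_, ?_⟩
  · intro t ht
    have hu := hu t ht
    have ha : AnalyticAt ℂ (fun t => u t * g t + f t) t := (hu.mul (hg t ht)).add (hf t ht)
    have hA : AnalyticAt ℂ A t :=
      ((ha.smul analyticAt_const).add ((hu.pow 2).smul analyticAt_const)).add analyticAt_const
    have hB : AnalyticAt ℂ B t :=
      ((ha.smul analyticAt_const).add ((hu.pow 2).smul analyticAt_const)).add analyticAt_const
    exact ((hu.smul ((analyticAt_const.mul (hM t ht)).mul hB)).add ((hA.mul (hN t ht)).mul hB)).add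
      (hu.smul ((hA.mul (hM t ht)).mul analyticAt_const))
  · intro t ht h
    have hA : A t = u t • Γ t := by
      rw [hΓ t ht h]
      ext i j
      fin_cases i <;> fin_cases j <;> simp [A, h] <;> field_simp
    have hB : B t = u t • (Γ t)⁻¹ := by
      have hinv : (Γ t)⁻¹ = (u t)⁻¹ • B t := by
        apply Matrix.inv_eq_right_inv
        rw [hΓ t ht h]
        ext i j
        fin_cases i <;> fin_cases j <;> simp [B, Matrix.mul_apply, Fin.sum_univ_two, h] <;>
          field_simp <;> ring
      rw [hinv, smul_inv_smul₀ h]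
    simp only [hA, hB, Matrix.smul_mul, Matrix.mul_smul, smul_smul, smul_add, pow_two]
end

section
/- Let a ∈ ℂ, let d₁ ≥ d₂ be integers, and let E′ be an upper-triangular 2×2 complex matrix (i.e. E′₂₁ = 0). Define, for z ≠ a, ω(z) = diag(d₁, d₂)/(z−a) + diag((z−a)^{d₁}, (z−a)^{d₂})·E′·diag((z−a)^{−d₁}, (z−a)^{−d₂})/(z−a). Then the function z ↦ (z−a)·ω(z) extends holomorphically to z = a; that is, ω has a pole of order at most one at a. -/
attribute [local instance] Matrix.linftyOpNormedAddCommGroup Matrix.linftyOpNormedRing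
  Matrix.linftyOpNormedAlgebra

open scoped Topology

/-- For integers d₁ ≥ d₂ and an upper-triangular E′, the form
ω(z) = diag(d₁,d₂)/(z−a) + (z−a)^{diag(d₁,d₂)}·E′·(z−a)^{−diag(d₁,d₂)}/(z−a)
has a pole of order at most one at a: (z−a)·ω(z) extends holomorphically to z = a. -/
theorem stmt_12 (a : ℂ) (d1 d2 : ℤ) (hd : d2 ≤ d1)
    (E' : M2) (hE' : E' 1 0 = 0)
    (ω : ℂ → M2)
    (hω : ∀ z : ℂ, z ≠ a → ω z = (z - a)⁻¹ • !![(d1 : ℂ), 0; 0, (d2 : ℂ)]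
      + (z - a)⁻¹ • (!![(z - a) ^ d1, 0; 0, (z - a) ^ d2] * E'
          * !![(z - a) ^ (-d1), 0; 0, (z - a) ^ (-d2)])) :
    ∃ g : ℂ → M2, AnalyticAt ℂ g a ∧ ∀ᶠ z in 𝓝[≠] a, g z = (z - a) • ω z := by
  obtain ⟨n, hn⟩ := Int.eq_ofNat_of_zero_le (sub_nonneg.mpr hd)
  refine ⟨fun z => !![(d1 : ℂ) + E' 0 0, 0; 0, (d2 : ℂ) + E' 1 1]
    + (z - a) ^ n • !![0, E' 0 1; 0, 0], by fun_prop, ?_⟩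
  filter_upwards [self_mem_nhdsWithin] with z hz
  have hza : z - a ≠ 0 := sub_ne_zero.mpr hz
  have hpow : (z - a) ^ n = (z - a) ^ d1 * (z - a) ^ (-d2) := by
    rw [← zpow_add₀ hza, ← sub_eq_add_neg, hn, zpow_natCast]
  have h1 : (z - a) ^ d1 ≠ 0 := zpow_ne_zero _ hza
  have h2 : (z - a) ^ d2 ≠ 0 := zpow_ne_zero _ hza
  rw [hω z hz, ← smul_add, smul_inv_smul₀ hza, hpow, Matrix.eta_fin_two E', hE']
  ext i j
  fin_cases i <;> fin_cases j <;>
    simp [zpow_neg] <;> field_simp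
end
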